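/- Let φ be a C^∞ function on a neighborhood of the origin in ℝ² that has a singularity of type E₇ at the origin. Then there exist an invertible linear map T : ℝ² → ℝ², integers m ≥ 2 and k₀ ≥ 5, C^∞ functions b₃ of two variables and b₁, b₀, ω of one variable, all defined near the origin, with b₃(0,0) ≠ 0 and b₁(0) ≠ 0, such that for all (x₁,x₂) in a neighborhood of the origin: φ(T(x₁,x₂)) = b₃(x₁,x₂)·(x₂ − x₁^m·ω(x₁))³ + x₂·x₁³·b₁(x₁) + x₁^{k₀}·b₀(x₁). -/

import Mathlib

open Set

/-- `φ` (with domain `U`, a neighborhood of the origin) has a singularity of type `E₇`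
at the origin. -/
def HasE7 (φ : ℝ × ℝ → ℝ) (U : Set (ℝ × ℝ)) : Prop :=
  ∃ V ∈ nhds (0 : ℝ × ℝ), ∃ ϕ : ℝ × ℝ → ℝ × ℝ,
    ContDiffOn ℝ 1 ϕ V ∧ ϕ 0 = 0 ∧ ϕ '' V ⊆ U ∧
    LinearMap.det ((fderiv ℝ ϕ 0) : (ℝ × ℝ) →ₗ[ℝ] ℝ × ℝ) ≠ 0 ∧
    ∀ y ∈ V, φ (ϕ y) = y.2 * y.1 ^ 3 + y.2 ^ 3

open Filter Topology

/-- The partial derivative in the second variable of a function on the plane. -/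
noncomputable def partialSnd (f : ℝ × ℝ → ℝ) (p : ℝ × ℝ) : ℝ := fderiv ℝ f p (0, 1)

protected theorem ContDiff.partialSnd {f : ℝ × ℝ → ℝ} (hf : ContDiff ℝ (⊤ : ℕ∞) f) :
    ContDiff ℝ (⊤ : ℕ∞) (partialSnd f) :=
  (hf.fderiv_right (m := (⊤ : ℕ∞)) (by simp)).clm_apply contDiff_const

theorem ContDiff.hasDerivAt_partialSnd {f : ℝ × ℝ → ℝ} (hf : ContDiff ℝ (⊤ : ℕ∞) f) (t u : ℝ) :
    HasDerivAt (fun s => f (t, s)) (partialSnd f (t, u)) u :=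
  ((hf.differentiable (by simp)) (t, u)).hasFDerivAt.comp_hasDerivAt u
    ((hasDerivAt_const u t).prodMk (hasDerivAt_id u))

theorem contDiff_intervalIntegral_param_nat (n : ℕ) :
    ∀ {E : Type} [NormedAddCommGroup E] [NormedSpace ℝ E] {f : (ℝ × ℝ) × ℝ → E},
      ContDiff ℝ n f → ContDiff ℝ n (fun x => ∫ s in (0 : ℝ)..1, f (x, s)) := by
  induction n with
  | zero =>
    intro E _ _ f hf
    rw [Nat.cast_zero, contDiff_zero] at hf ⊢
    exact intervalIntegral.continuous_parametric_intervalIntegral_of_continuous'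
      (f := fun x s => f (x, s)) hf 0 1
  | succ n ih =>
    intro E _ _ f hf
    have hc : Continuous f := hf.continuous
    have hd : ContDiff ℝ n (fun q : (ℝ × ℝ) × ℝ =>
        (fderiv ℝ f q).comp (ContinuousLinearMap.inl ℝ (ℝ × ℝ) ℝ)) :=
      (hf.fderiv_right (m := n) (by norm_cast)).clm_comp contDiff_const
    have hdc := hd.continuous
    have hder : ∀ x, HasFDerivAt (fun x => ∫ s in (0 : ℝ)..1, f (x, s))
        (∫ s in (0 : ℝ)..1, (fderiv ℝ f (x, s)).comp (ContinuousLinearMap.inl ℝ (ℝ × ℝ) ℝ)) x := by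
      intro x
      obtain ⟨C, hC⟩ := ((isCompact_closedBall x 1).prod
        (isCompact_Icc (a := (0 : ℝ)) (b := 1))).exists_bound_of_continuousOn hdc.continuousOn
      refine (intervalIntegral.hasFDerivAt_integral_of_dominated_of_fderiv_le
        (F := fun x s => f (x, s))
        (F' := fun x s => (fderiv ℝ f (x, s)).comp (ContinuousLinearMap.inl ℝ (ℝ × ℝ) ℝ))
        (bound := fun _ => C) (Metric.ball_mem_nhds x one_pos) ?_ ?_ ?_ ?_ ?_ ?_)
      · exact Eventually.of_forall fun y =>
          (show Continuous fun s => f (y, s) by fun_prop).aestronglyMeasurable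
      · exact (show Continuous fun s => f (x, s) by fun_prop).intervalIntegrable _ _
      · exact (hdc.comp (by fun_prop : Continuous fun s : ℝ => (x, s))).aestronglyMeasurable
      · refine Eventually.of_forall fun s hs y hy => hC (y, s) ⟨Metric.ball_subset_closedBall hy, ?_⟩
        rw [uIoc_of_le zero_le_one] at hs
        exact Ioc_subset_Icc_self hs
      · exact intervalIntegrable_const
      · refine Eventually.of_forall fun s _ y _ => ?_
        exact ((hf.differentiable (by simp)) (y, s)).hasFDerivAt.comp y
          (hasFDerivAt_prodMk_left y s)
    rw [Nat.cast_add, Nat.cast_one, contDiff_succ_iff_hasFDerivAt]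
    exact ⟨_, ih hd, hder⟩

theorem contDiff_intervalIntegral_param {f : (ℝ × ℝ) × ℝ → ℝ} (hf : ContDiff ℝ (⊤ : ℕ∞) f) :
    ContDiff ℝ (⊤ : ℕ∞) (fun x => ∫ s in (0 : ℝ)..1, f (x, s)) :=
  contDiff_infty.2 fun n => contDiff_intervalIntegral_param_nat n (contDiff_infty.1 hf n)

/-- Hadamard's lemma in the second variable. -/
theorem ContDiff.exists_eq_add_snd_mul {f : ℝ × ℝ → ℝ} (hf : ContDiff ℝ (⊤ : ℕ∞) f) :
    ∃ h : ℝ × ℝ → ℝ, ContDiff ℝ (⊤ : ℕ∞) h ∧ ∀ t u, f (t, u) = f (t, 0) + u * h (t, u) := by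
  refine ⟨fun x => ∫ s in (0 : ℝ)..1, partialSnd f (x.1, s * x.2),
    contDiff_intervalIntegral_param (f := fun q => partialSnd f (q.1.1, q.2 * q.1.2))
      (hf.partialSnd.comp (by fun_prop)), fun t u => ?_⟩
  have h := intervalIntegral.integral_eq_sub_of_hasDerivAt (a := 0) (b := 1)
    (f := fun s => f (t, s * u)) (f' := fun s => u * partialSnd f (t, s * u)) (fun s _ => by
      have := (hf.hasDerivAt_partialSnd t (s * u)).comp s ((hasDerivAt_id s).mul_const u)
      simpa [mul_comm, Function.comp_def] using this)
    ((continuous_const.mul (hf.partialSnd.continuous.comp (by fun_prop))).intervalIntegrable _ _)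
  rw [intervalIntegral.integral_const_mul] at h
  simp only [one_mul, zero_mul] at h
  simp only [h]
  ring

/-- Hadamard's lemma in one variable. -/
theorem ContDiff.exists_eq_add_id_mul {f : ℝ → ℝ} (hf : ContDiff ℝ (⊤ : ℕ∞) f) :
    ∃ h : ℝ → ℝ, ContDiff ℝ (⊤ : ℕ∞) h ∧ ∀ t, f t = f 0 + t * h t := by
  obtain ⟨h, hh, he⟩ := (hf.comp contDiff_snd : ContDiff ℝ (⊤ : ℕ∞) fun p : ℝ × ℝ => f p.2)
    |>.exists_eq_add_snd_mul
  exact ⟨fun t => h (0, t), hh.comp (by fun_prop), fun t => he 0 t⟩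

/-- Second-order Taylor expansion in the second variable with smooth coefficients. -/
theorem ContDiff.exists_cubic_expansion {f : ℝ × ℝ → ℝ} (hf : ContDiff ℝ (⊤ : ℕ∞) f) :
    ∃ (p₀ p₁ p₂ : ℝ → ℝ) (b : ℝ × ℝ → ℝ), ContDiff ℝ (⊤ : ℕ∞) p₀ ∧ ContDiff ℝ (⊤ : ℕ∞) p₁ ∧
      ContDiff ℝ (⊤ : ℕ∞) p₂ ∧ ContDiff ℝ (⊤ : ℕ∞) b ∧
      ∀ t u, f (t, u) = p₀ t + u * p₁ t + u ^ 2 * p₂ t + u ^ 3 * b (t, u) := by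
  obtain ⟨f₁, hf₁, h₁⟩ := hf.exists_eq_add_snd_mul
  obtain ⟨f₂, hf₂, h₂⟩ := hf₁.exists_eq_add_snd_mul
  obtain ⟨f₃, hf₃, h₃⟩ := hf₂.exists_eq_add_snd_mul
  refine ⟨fun t => f (t, 0), fun t => f₁ (t, 0), fun t => f₂ (t, 0), f₃, hf.comp (by fun_prop),
    hf₁.comp (by fun_prop), hf₂.comp (by fun_prop), hf₃, fun t u => ?_⟩
  rw [h₁, h₂, h₃]
  ring

section cubicExpansion

variable {f b : ℝ × ℝ → ℝ} {p₀ p₁ p₂ : ℝ → ℝ}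

theorem partialSnd_of_cubic_expansion (hf : ContDiff ℝ (⊤ : ℕ∞) f) (hb : ContDiff ℝ (⊤ : ℕ∞) b)
    (h : ∀ t u, f (t, u) = p₀ t + u * p₁ t + u ^ 2 * p₂ t + u ^ 3 * b (t, u)) (t u : ℝ) :
    partialSnd f (t, u) =
      p₁ t + u * (2 * p₂ t) + u ^ 2 * (3 * b (t, u) + u * partialSnd b (t, u)) := by
  refine (hf.hasDerivAt_partialSnd t u).unique ?_
  simp only [h]
  have hi := hasDerivAt_id u
  refine (((((hasDerivAt_const u (p₀ t)).add (hi.mul_const (p₁ t))).add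
    ((hi.pow 2).mul_const (p₂ t))).add
    ((hi.pow 3).mul (hb.hasDerivAt_partialSnd t u))).congr_deriv ?_)
  simp
  ring

theorem partialSnd_partialSnd_of_cubic_expansion (hf : ContDiff ℝ (⊤ : ℕ∞) f)
    (hb : ContDiff ℝ (⊤ : ℕ∞) b)
    (h : ∀ t u, f (t, u) = p₀ t + u * p₁ t + u ^ 2 * p₂ t + u ^ 3 * b (t, u)) (t u : ℝ) :
    partialSnd (partialSnd f) (t, u) = 2 * p₂ t +
      u * (6 * b (t, u) + 6 * u * partialSnd b (t, u) +
        u ^ 2 * partialSnd (partialSnd b) (t, u)) := by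
  refine (hf.partialSnd.hasDerivAt_partialSnd t u).unique ?_
  simp only [partialSnd_of_cubic_expansion hf hb h]
  have hi := hasDerivAt_id u
  refine ((((hasDerivAt_const u (p₁ t)).add (hi.mul_const (2 * p₂ t))).add
    ((hi.pow 2).mul (((hb.hasDerivAt_partialSnd t u).const_mul 3).add
      (hi.mul (hb.partialSnd.hasDerivAt_partialSnd t u))))).congr_deriv ?_)
  simp
  ring

theorem partialSnd_partialSnd_partialSnd_of_cubic_expansion (hf : ContDiff ℝ (⊤ : ℕ∞) f)
    (hb : ContDiff ℝ (⊤ : ℕ∞) b)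
    (h : ∀ t u, f (t, u) = p₀ t + u * p₁ t + u ^ 2 * p₂ t + u ^ 3 * b (t, u)) (t : ℝ) :
    partialSnd (partialSnd (partialSnd f)) (t, 0) = 6 * b (t, 0) := by
  refine (hf.partialSnd.partialSnd.hasDerivAt_partialSnd t 0).unique ?_
  simp only [partialSnd_partialSnd_of_cubic_expansion hf hb h]
  have hi := hasDerivAt_id (0 : ℝ)
  refine (((hasDerivAt_const 0 (2 * p₂ t)).add (hi.mul
    ((((hb.hasDerivAt_partialSnd t 0).const_mul 6).add
      ((hi.const_mul 6).mul (hb.partialSnd.hasDerivAt_partialSnd t 0))).add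
      ((hi.pow 2).mul (hb.partialSnd.partialSnd.hasDerivAt_partialSnd t 0))))).congr_deriv ?_)
  simp

end cubicExpansion

theorem ContDiffOn.exists_contDiff_eventuallyEq {E : Type*} [NormedAddCommGroup E]
    [NormedSpace ℝ E] [FiniteDimensional ℝ E] {f : E → ℝ} {s : Set E} {x : E}
    (hf : ContDiffOn ℝ (⊤ : ℕ∞) f s) (hs : s ∈ 𝓝 x) :
    ∃ g : E → ℝ, ContDiff ℝ (⊤ : ℕ∞) g ∧ g =ᶠ[𝓝 x] f := by
  obtain ⟨r, hr, hrs⟩ := Metric.mem_nhds_iff.1 hs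
  let η : ContDiffBump x := ⟨r / 3, r / 2, by positivity, by linarith⟩
  refine ⟨fun y => η y * f y, contDiff_iff_contDiffAt.2 fun y => ?_, ?_⟩
  · by_cases hy : y ∈ Metric.ball x r
    · exact η.contDiffAt.mul
        (hf.contDiffAt (mem_of_superset (Metric.isOpen_ball.mem_nhds hy) hrs))
    · have hy' : y ∉ tsupport η := by
        rw [η.tsupport_eq]
        exact fun h => hy (Metric.closedBall_subset_ball (show r / 2 < r by linarith) h)
      refine (contDiffAt_const (c := (0 : ℝ))).congr_of_eventuallyEq ?_
      filter_upwards [notMem_tsupport_iff_eventuallyEq.1 hy'] with z hz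
      simp [hz]
  · filter_upwards [η.eventuallyEq_one] with y hy
    simp [hy]

theorem exists_continuousLinearEquiv_eq_fst_prod {l : ℝ × ℝ →L[ℝ] ℝ} (hl : l (0, 1) ≠ 0) :
    ∃ e : (ℝ × ℝ) ≃L[ℝ] ℝ × ℝ,
      (e : ℝ × ℝ →L[ℝ] ℝ × ℝ) = (ContinuousLinearMap.fst ℝ ℝ ℝ).prod l := by
  have hinj : Function.Injective
      (((ContinuousLinearMap.fst ℝ ℝ ℝ).prod l : ℝ × ℝ →L[ℝ] ℝ × ℝ) : ℝ × ℝ →ₗ[ℝ] ℝ × ℝ) := by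
    refine (injective_iff_map_eq_zero _).2 ?_
    rintro ⟨a, b⟩ h
    simp only [ContinuousLinearMap.coe_coe, ContinuousLinearMap.prod_apply,
      ContinuousLinearMap.coe_fst', Prod.mk_eq_zero] at h
    obtain ⟨rfl, h⟩ := h
    have : ((0 : ℝ), b) = b • ((0 : ℝ), (1 : ℝ)) := by simp
    rw [this, map_smul, smul_eq_mul, mul_eq_zero, or_iff_left hl] at h
    simp [h]
  exact ⟨(LinearEquiv.ofInjectiveEndo _ hinj).toContinuousLinearEquiv, by ext <;> simp⟩

/-- Smooth implicit function theorem in the plane, at a point where the first partial derivative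
vanishes; the implicit function is extended to a smooth function on the whole line. -/
theorem exists_contDiff_implicit {G : ℝ × ℝ → ℝ} (hG : ContDiff ℝ (⊤ : ℕ∞) G) (h0 : G (0, 0) = 0)
    (h1 : fderiv ℝ G (0, 0) (1, 0) = 0) (h2 : partialSnd G (0, 0) ≠ 0) :
    ∃ g : ℝ → ℝ, ContDiff ℝ (⊤ : ℕ∞) g ∧ g 0 = 0 ∧ deriv g 0 = 0 ∧
      ∀ᶠ t in 𝓝 0, G (t, g t) = 0 := by
  have hGd : ∀ p, HasFDerivAt G (fderiv ℝ G p) p :=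
    fun p => (hG.differentiable (by simp) p).hasFDerivAt
  have hΦc : ContDiff ℝ (⊤ : ℕ∞) (fun p : ℝ × ℝ => (p.1, G p)) := contDiff_fst.prodMk hG
  have hΦd : ∀ p, HasFDerivAt (fun p : ℝ × ℝ => (p.1, G p))
      ((ContinuousLinearMap.fst ℝ ℝ ℝ).prod (fderiv ℝ G p)) p :=
    fun p => hasFDerivAt_fst.prodMk (hGd p)
  obtain ⟨e, he⟩ := exists_continuousLinearEquiv_eq_fst_prod h2
  have hΦ0 : HasFDerivAt (fun p : ℝ × ℝ => (p.1, G p)) (e : ℝ × ℝ →L[ℝ] ℝ × ℝ) (0, 0) :=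
    he ▸ hΦd (0, 0)
  let Φ := hΦc.contDiffAt.toOpenPartialHomeomorph _ hΦ0 (by simp)
  have hΦ : ∀ p, Φ p = (p.1, G p) := fun _ => rfl
  have hs : ((0 : ℝ), (0 : ℝ)) ∈ Φ.source :=
    hΦc.contDiffAt.mem_toOpenPartialHomeomorph_source hΦ0 (by simp)
  have hΦ00 : Φ (0, 0) = (0, 0) := by rw [hΦ, h0]
  have ht : ((0 : ℝ), (0 : ℝ)) ∈ Φ.target := hΦ00 ▸ Φ.map_source hs
  have hsymm0 : Φ.symm (0, 0) = (0, 0) := by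
    have := Φ.left_inv hs
    rwa [hΦ00] at this
  have hcont : ContinuousAt Φ.symm (0, 0) := Φ.continuousAt_symm ht
  have hne : ∀ᶠ q in 𝓝 ((0 : ℝ), (0 : ℝ)), partialSnd G (Φ.symm q) ≠ 0 := by
    have : ContinuousAt (fun q => partialSnd G (Φ.symm q)) (0, 0) :=
      hG.partialSnd.continuous.continuousAt.comp hcont
    refine this.eventually_ne ?_
    rwa [hsymm0]
  have hline : Tendsto (fun t : ℝ => (t, (0 : ℝ))) (𝓝 0) (𝓝 (0, 0)) :=
    (show Continuous fun t : ℝ => (t, (0 : ℝ)) by fun_prop).tendsto 0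
  have hsm : ∀ᶠ q in 𝓝 ((0 : ℝ), (0 : ℝ)), ContDiffAt ℝ (⊤ : ℕ∞) Φ.symm q := by
    filter_upwards [hne, Φ.open_target.mem_nhds ht] with q hq hqt
    obtain ⟨e', he'⟩ := exists_continuousLinearEquiv_eq_fst_prod hq
    exact Φ.contDiffAt_symm (f₀' := e') hqt (he' ▸ hΦd _) hΦc.contDiffAt
  have hg₀ : ∀ᶠ t in 𝓝 (0 : ℝ), ContDiffAt ℝ (⊤ : ℕ∞) (fun t => (Φ.symm (t, 0)).2) t := by
    filter_upwards [hline.eventually hsm] with t htt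
    exact contDiffAt_snd.comp t (htt.comp t (by fun_prop))
  obtain ⟨g, hg, hge⟩ := ContDiffOn.exists_contDiff_eventuallyEq (x := (0 : ℝ))
    (f := fun t => (Φ.symm (t, 0)).2)
    (fun t (htt : ContDiffAt ℝ (⊤ : ℕ∞) (fun t => (Φ.symm (t, 0)).2) t) => htt.contDiffWithinAt) hg₀
  have hg0 : g 0 = 0 := by simp [hge.self_of_nhds, hsymm0]
  have hGg : ∀ᶠ t in 𝓝 0, G (t, g t) = 0 := by
    filter_upwards [hge, hline.eventually (Φ.open_target.mem_nhds ht)] with t hgt htt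
    have hr := Φ.right_inv htt
    rw [hΦ, Prod.mk.injEq] at hr
    have hp : (t, g t) = Φ.symm (t, 0) := Prod.ext hr.1.symm hgt
    rw [hp, hr.2]
  refine ⟨g, hg, hg0, ?_, hGg⟩
  have hgd : HasDerivAt g (deriv g 0) 0 := (hg.differentiable (by simp) 0).hasDerivAt
  have hcomp : HasDerivAt (fun t => G (t, g t)) (fderiv ℝ G (0, 0) (1, deriv g 0)) 0 := by
    have hG0 : HasFDerivAt G (fderiv ℝ G (0, 0)) (0, g 0) := by
      rw [hg0]; exact hGd _
    exact hG0.comp_hasDerivAt (0 : ℝ) ((hasDerivAt_id 0).prodMk hgd)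
  have hz := hcomp.unique ((hasDerivAt_const (0 : ℝ) (0 : ℝ)).congr_of_eventuallyEq hGg)
  have hv : ((1 : ℝ), deriv g 0) = (1, 0) + deriv g 0 • ((0 : ℝ), (1 : ℝ)) := by simp
  rw [hv, map_add, map_smul, h1, zero_add, smul_eq_mul, mul_eq_zero] at hz
  exact hz.resolve_right h2

/-- A smooth function that is `o(t ^ n)` along some filter accumulating at `0` is divisible by
`t ^ (n + 1)`. -/
theorem ContDiff.exists_eq_pow_succ_mul {ι : Type*} {l : Filter ι} [l.NeBot] {τ : ι → ℝ}
    (hτ : Tendsto τ l (𝓝[≠] 0)) (n : ℕ) {f : ℝ → ℝ} (hf : ContDiff ℝ (⊤ : ℕ∞) f)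
    (h : Tendsto (fun i => f (τ i) / τ i ^ n) l (𝓝 0)) :
    ∃ k : ℝ → ℝ, ContDiff ℝ (⊤ : ℕ∞) k ∧ ∀ t, f t = t ^ (n + 1) * k t := by
  obtain ⟨hτ0, hτne⟩ := tendsto_nhdsWithin_iff.1 hτ
  have key : ∀ k : ℝ → ℝ, ContDiff ℝ (⊤ : ℕ∞) k → Tendsto (fun i => k (τ i)) l (𝓝 0) →
      ∃ k' : ℝ → ℝ, ContDiff ℝ (⊤ : ℕ∞) k' ∧ ∀ t, k t = t * k' t := by
    intro k hk hk0
    obtain ⟨k', hk', he⟩ := hk.exists_eq_add_id_mul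
    have : k 0 = 0 := tendsto_nhds_unique ((hk.continuous.tendsto 0).comp hτ0) hk0
    exact ⟨k', hk', fun t => by rw [he, this, zero_add]⟩
  induction n with
  | zero => simpa using key f hf (by simpa using h)
  | succ n ih =>
    obtain ⟨k, hk, he⟩ := ih (by
      have := h.mul hτ0
      rw [zero_mul] at this
      refine this.congr' ?_
      filter_upwards [hτne] with i hi
      have : τ i ≠ 0 := hi
      rw [pow_succ]
      field_simp)
    obtain ⟨k', hk', he'⟩ := key k hk (by
      refine h.congr' ?_
      filter_upwards [hτne] with i hi
      have : τ i ≠ 0 := hi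
      rw [he]
      field_simp)
    exact ⟨k', hk', fun t => by rw [he, he']; ring⟩

theorem HasFDerivAt.exists_tendsto_rescaled {χ : ℝ × ℝ → ℝ × ℝ} (hχ0 : χ 0 = 0)
    (hχ : HasFDerivAt χ (ContinuousLinearMap.id ℝ (ℝ × ℝ)) 0) (v : ℝ × ℝ) :
    ∃ X Y : ℝ → ℝ, Tendsto X (𝓝[≠] 0) (𝓝 v.1) ∧ Tendsto Y (𝓝[≠] 0) (𝓝 v.2) ∧
      ∀ᶠ r in 𝓝[≠] (0 : ℝ), χ (r • v) = (r * X r, r * Y r) := by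
  have hd : HasDerivAt (fun r : ℝ => χ (r • v)) v 0 := by
    have hχ' : HasFDerivAt χ (ContinuousLinearMap.id ℝ (ℝ × ℝ)) ((0 : ℝ) • v) := by
      rwa [zero_smul]
    exact (hχ'.comp_hasDerivAt (0 : ℝ) ((hasDerivAt_id (0 : ℝ)).smul_const v)).congr_deriv (by simp)
  have hs := hasDerivAt_iff_tendsto_slope_zero.1 hd
  simp only [zero_add, zero_smul, hχ0, sub_zero] at hs
  refine ⟨_, _, (continuous_fst.tendsto v).comp hs, (continuous_snd.tendsto v).comp hs, ?_⟩
  filter_upwards [self_mem_nhdsWithin] with r hr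
  have hr : r ≠ 0 := hr
  ext <;> simp [hr]

/-- The 3-jet at the origin of a function with normal form `y₂ y₁³ + y₂³` in coordinates tangent
to the identity. -/
theorem threeJet_of_comp_eq {ψ : ℝ × ℝ → ℝ} (hψ : ContDiff ℝ (⊤ : ℕ∞) ψ) {χ : ℝ × ℝ → ℝ × ℝ}
    (hχ0 : χ 0 = 0) (hχ : HasFDerivAt χ (ContinuousLinearMap.id ℝ (ℝ × ℝ)) 0)
    (h : ∀ᶠ y in 𝓝 (0 : ℝ × ℝ), ψ (χ y) = y.2 * y.1 ^ 3 + y.2 ^ 3) :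
    partialSnd (partialSnd ψ) (0, 0) = 0 ∧
      fderiv ℝ (partialSnd (partialSnd ψ)) (0, 0) (1, 0) = 0 ∧
      partialSnd (partialSnd (partialSnd ψ)) (0, 0) = 6 := by
  obtain ⟨p₀, p₁, p₂, p₃, hp₀, hp₁, hp₂, hp₃, hψe⟩ := hψ.exists_cubic_expansion
  obtain ⟨p₀₁, hp₀₁, e₀⟩ := hp₀.exists_eq_add_id_mul
  obtain ⟨p₀₂, hp₀₂, e₀₁⟩ := hp₀₁.exists_eq_add_id_mul
  obtain ⟨p₀₃, hp₀₃, e₀₂⟩ := hp₀₂.exists_eq_add_id_mul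
  obtain ⟨p₁₁, hp₁₁, e₁⟩ := hp₁.exists_eq_add_id_mul
  obtain ⟨p₁₂, hp₁₂, e₁₁⟩ := hp₁₁.exists_eq_add_id_mul
  obtain ⟨p₂₁, hp₂₁, e₂⟩ := hp₂.exists_eq_add_id_mul
  have hψ0 : p₀ 0 = 0 := by
    have h1 := h.self_of_nhds
    have h2 := hψe 0 0
    rw [hχ0] at h1
    change ψ (0, 0) = _ at h1
    simp [h1] at h2
    exact h2.symm
  have hid : Tendsto (fun r : ℝ => r) (𝓝[≠] 0) (𝓝 0) :=
    tendsto_nhdsWithin_of_tendsto_nhds tendsto_id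
  have expand : ∀ v : ℝ × ℝ, ∃ X Y Z : ℝ → ℝ, Tendsto X (𝓝[≠] 0) (𝓝 v.1) ∧
      Tendsto Y (𝓝[≠] 0) (𝓝 v.2) ∧
      Tendsto Z (𝓝[≠] 0) (𝓝 (p₀₃ 0 * v.1 ^ 3 + p₁₂ 0 * v.1 ^ 2 * v.2 + p₂₁ 0 * v.1 * v.2 ^ 2 +
        p₃ (0, 0) * v.2 ^ 3)) ∧
      ∀ᶠ r in 𝓝[≠] (0 : ℝ), p₀₁ 0 * X r + p₁ 0 * Y r + r * (p₀₂ 0 * X r ^ 2 + p₁₁ 0 * X r * Y r +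
        p₂ 0 * Y r ^ 2) + r ^ 2 * Z r = r ^ 2 * (r * v.2 * v.1 ^ 3 + v.2 ^ 3) := by
    intro v
    obtain ⟨X, Y, hX, hY, hXY⟩ := hχ.exists_tendsto_rescaled hχ0 v
    have hrX : Tendsto (fun r => r * X r) (𝓝[≠] 0) (𝓝 0) := by simpa using hid.mul hX
    have hrY : Tendsto (fun r => r * Y r) (𝓝[≠] 0) (𝓝 0) := by simpa using hid.mul hY
    refine ⟨X, Y, fun r => p₀₃ (r * X r) * X r ^ 3 + p₁₂ (r * X r) * X r ^ 2 * Y r +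
      p₂₁ (r * X r) * X r * Y r ^ 2 + p₃ (r * X r, r * Y r) * Y r ^ 3, hX, hY, ?_, ?_⟩
    · exact (((((hp₀₃.continuous.tendsto 0).comp hrX).mul (hX.pow 3)).add
        ((((hp₁₂.continuous.tendsto 0).comp hrX).mul (hX.pow 2)).mul hY)).add
        ((((hp₂₁.continuous.tendsto 0).comp hrX).mul hX).mul (hY.pow 2))).add
        (((hp₃.continuous.tendsto (0, 0)).comp (hrX.prodMk_nhds hrY)).mul (hY.pow 3))
    · have hv : Tendsto (fun r : ℝ => r • v) (𝓝[≠] 0) (𝓝 0) := by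
        simpa using hid.smul_const v
      filter_upwards [hXY, hv.eventually h, self_mem_nhdsWithin] with r hr1 hr2 hr
      have hr : r ≠ 0 := hr
      rw [hr1, hψe, e₀, e₀₁, e₀₂, e₁, e₁₁, e₂, hψ0] at hr2
      simp only [Prod.smul_fst, Prod.smul_snd, smul_eq_mul] at hr2
      refine mul_left_cancel₀ hr ?_
      linear_combination hr2
  have linear : ∀ v : ℝ × ℝ, p₀₁ 0 * v.1 + p₁ 0 * v.2 = 0 := by
    intro v
    obtain ⟨X, Y, Z, hX, hY, hZ, he⟩ := expand v
    have hl := ((((hX.const_mul (p₀₁ 0)).add (hY.const_mul (p₁ 0))).add (hid.mul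
      ((((hX.pow 2).const_mul (p₀₂ 0)).add ((hX.const_mul (p₁₁ 0)).mul hY)).add
      ((hY.pow 2).const_mul (p₂ 0))))).add ((hid.pow 2).mul hZ))
    have hr := (hid.pow 2).mul (((hid.mul_const v.2).mul_const (v.1 ^ 3)).add_const (v.2 ^ 3))
    simpa using tendsto_nhds_unique (hl.congr' he) hr
  have a₁ : p₀₁ 0 = 0 := by simpa using linear (1, 0)
  have b₀ : p₁ 0 = 0 := by simpa using linear (0, 1)
  have quadratic : ∀ v : ℝ × ℝ, p₀₂ 0 * v.1 ^ 2 + p₁₁ 0 * v.1 * v.2 + p₂ 0 * v.2 ^ 2 = 0 := by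
    intro v
    obtain ⟨X, Y, Z, hX, hY, hZ, he⟩ := expand v
    have hl := (((((hX.pow 2).const_mul (p₀₂ 0)).add ((hX.const_mul (p₁₁ 0)).mul hY)).add
      ((hY.pow 2).const_mul (p₂ 0)))).add (hid.mul hZ)
    have hr := hid.mul (((hid.mul_const v.2).mul_const (v.1 ^ 3)).add_const (v.2 ^ 3))
    have := tendsto_nhds_unique (hl.congr' (by
      filter_upwards [he, self_mem_nhdsWithin] with r hr1 hr
      have hr : r ≠ 0 := hr
      rw [a₁, b₀] at hr1
      refine mul_left_cancel₀ hr ?_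
      linear_combination hr1)) hr
    simpa using this
  have a₂ : p₀₂ 0 = 0 := by simpa using quadratic (1, 0)
  have c₀ : p₂ 0 = 0 := by simpa using quadratic (0, 1)
  have b₁ : p₁₁ 0 = 0 := by simpa [a₂, c₀] using quadratic (1, 1)
  have cubic : ∀ v : ℝ × ℝ, p₀₃ 0 * v.1 ^ 3 + p₁₂ 0 * v.1 ^ 2 * v.2 + p₂₁ 0 * v.1 * v.2 ^ 2 +
      p₃ (0, 0) * v.2 ^ 3 = v.2 ^ 3 := by
    intro v
    obtain ⟨X, Y, Z, hX, hY, hZ, he⟩ := expand v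
    have hr := ((hid.mul_const v.2).mul_const (v.1 ^ 3)).add_const (v.2 ^ 3)
    have := tendsto_nhds_unique (hZ.congr' (by
      filter_upwards [he, self_mem_nhdsWithin] with r hr1 hr
      have hr : r ≠ 0 := hr
      rw [a₁, b₀, a₂, b₁, c₀] at hr1
      refine mul_left_cancel₀ (pow_ne_zero 2 hr) ?_
      linear_combination hr1)) hr
    simpa using this
  have q10 := cubic (1, 0)
  have q01 := cubic (0, 1)
  have q11 := cubic (1, 1)
  have q1m := cubic (1, -1)
  norm_num at q10 q01 q11 q1m
  have c₁ : p₂₁ 0 = 0 := by linarith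
  have h22 := partialSnd_partialSnd_of_cubic_expansion hψ hp₃ hψe
  refine ⟨by simpa [c₀] using h22 0 0, ?_, by
    rw [partialSnd_partialSnd_partialSnd_of_cubic_expansion hψ hp₃ hψe, q01, mul_one]⟩
  have hc : HasDerivAt (fun t : ℝ => (t, (0 : ℝ))) (1, 0) 0 :=
    (hasDerivAt_id (0 : ℝ)).prodMk (hasDerivAt_const (0 : ℝ) (0 : ℝ))
  have hd := HasFDerivAt.comp_hasDerivAt (f := fun t : ℝ => (t, (0 : ℝ))) (0 : ℝ)
    ((hψ.partialSnd.partialSnd.differentiable (by simp)) (0, 0)).hasFDerivAt hc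
  refine hd.unique ?_
  have hfun : (partialSnd (partialSnd ψ) ∘ fun t : ℝ => (t, (0 : ℝ))) =
      fun t => 2 * (t * p₂₁ t) := by
    funext t
    simp [h22, e₂ t, c₀]
  rw [hfun]
  refine (((hasDerivAt_id (0 : ℝ)).mul
    ((hp₂₁.differentiable (by simp) 0).hasDerivAt)).const_mul 2).congr_deriv ?_
  simp [c₁]

/-- Asymptotics of the transversal derivative along the image of the first coordinate axis. -/
theorem tendsto_partialSnd_div_cube {ψ : ℝ × ℝ → ℝ} (hψ : ContDiff ℝ (⊤ : ℕ∞) ψ)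
    {χ : ℝ × ℝ → ℝ × ℝ} (hχc : ContDiffAt ℝ 1 χ 0)
    (hχ : fderiv ℝ χ 0 = ContinuousLinearMap.id ℝ (ℝ × ℝ))
    (h : ∀ᶠ y in 𝓝 (0 : ℝ × ℝ), ψ (χ y) = y.2 * y.1 ^ 3 + y.2 ^ 3) :
    Tendsto (fun r : ℝ => partialSnd ψ (χ (r, 0)) / r ^ 3) (𝓝[≠] 0) (𝓝 1) := by
  have hline : Tendsto (fun r : ℝ => (r, (0 : ℝ))) (𝓝[≠] 0) (𝓝 0) :=
    ((show Continuous fun t : ℝ => (t, (0 : ℝ)) by fun_prop).tendsto 0).mono_left nhdsWithin_le_nhds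
  have hM : Tendsto (fun r : ℝ => fderiv ℝ χ (r, 0)) (𝓝[≠] 0)
      (𝓝 (ContinuousLinearMap.id ℝ (ℝ × ℝ))) := by
    rw [← hχ]
    exact (hχc.continuousAt_fderiv (by simp)).tendsto.comp hline
  have hM1 : Tendsto (fun r : ℝ => fderiv ℝ χ (r, 0) (1, 0)) (𝓝[≠] 0) (𝓝 (1, 0)) :=
    ((ContinuousLinearMap.apply ℝ (ℝ × ℝ) _).continuous.tendsto _).comp hM
  have hM2 : Tendsto (fun r : ℝ => fderiv ℝ χ (r, 0) (0, 1)) (𝓝[≠] 0) (𝓝 (0, 1)) :=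
    ((ContinuousLinearMap.apply ℝ (ℝ × ℝ) _).continuous.tendsto _).comp hM
  have m11 : Tendsto (fun r : ℝ => (fderiv ℝ χ (r, 0) (1, 0)).1) (𝓝[≠] 0) (𝓝 1) := hM1.fst_nhds
  have m21 : Tendsto (fun r : ℝ => (fderiv ℝ χ (r, 0) (1, 0)).2) (𝓝[≠] 0) (𝓝 0) := hM1.snd_nhds
  have m12 : Tendsto (fun r : ℝ => (fderiv ℝ χ (r, 0) (0, 1)).1) (𝓝[≠] 0) (𝓝 0) := hM2.fst_nhds
  have m22 : Tendsto (fun r : ℝ => (fderiv ℝ χ (r, 0) (0, 1)).2) (𝓝[≠] 0) (𝓝 1) := hM2.snd_nhds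
  have hdet := (m22.mul m11).sub (m21.mul m12)
  simp only [mul_one, mul_zero, sub_zero] at hdet
  have hlim := m11.div hdet one_ne_zero
  rw [div_one] at hlim
  refine hlim.congr' ?_
  have hdiff : ∀ᶠ y in 𝓝 (0 : ℝ × ℝ), DifferentiableAt ℝ χ y := by
    filter_upwards [hχc.eventually (by simp)] with y hy
    exact hy.differentiableAt (by simp)
  filter_upwards [hline.eventually hdiff, hline.eventually h.eventually_nhds,
    hdet.eventually_ne one_ne_zero, self_mem_nhdsWithin] with r hd he hdet0 hr
  have hr : r ≠ 0 := hr
  have hψd : HasFDerivAt ψ (fderiv ℝ ψ (χ (r, 0))) (χ (r, 0)) :=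
    (hψ.differentiable (by simp) _).hasFDerivAt
  have hcomp := hψd.comp (r, 0) hd.hasFDerivAt
  have eq1 : fderiv ℝ ψ (χ (r, 0)) (fderiv ℝ χ (r, 0) (1, 0)) = 0 := by
    have hc : HasDerivAt (fun s : ℝ => (s, (0 : ℝ))) (1, 0) r :=
      (hasDerivAt_id r).prodMk (hasDerivAt_const r 0)
    refine (hcomp.comp_hasDerivAt r hc).unique
      ((hasDerivAt_const r (0 : ℝ)).congr_of_eventuallyEq ?_)
    filter_upwards [hc.continuousAt.eventually he] with s hs
    simp [hs]
  have eq2 : fderiv ℝ ψ (χ (r, 0)) (fderiv ℝ χ (r, 0) (0, 1)) = r ^ 3 := by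
    have hc : HasDerivAt (fun s : ℝ => (r, s)) (0, 1) 0 :=
      (hasDerivAt_const (0 : ℝ) r).prodMk (hasDerivAt_id (0 : ℝ))
    have hp : HasDerivAt (fun s : ℝ => s * r ^ 3 + s ^ 3) (r ^ 3) 0 := by
      exact (((hasDerivAt_id (0 : ℝ)).mul_const (r ^ 3)).add (hasDerivAt_pow 3 (0 : ℝ))).congr_deriv
        (by simp)
    refine (hcomp.comp_hasDerivAt (0 : ℝ) hc).unique (hp.congr_of_eventuallyEq ?_)
    filter_upwards [hc.continuousAt.eventually he] with s hs
    simp [hs]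
  have split : ∀ w : ℝ × ℝ, fderiv ℝ ψ (χ (r, 0)) w =
      w.1 * fderiv ℝ ψ (χ (r, 0)) (1, 0) + w.2 * partialSnd ψ (χ (r, 0)) := by
    intro w
    have hw : w = w.1 • ((1 : ℝ), (0 : ℝ)) + w.2 • ((0 : ℝ), (1 : ℝ)) := by ext <;> simp
    conv_lhs => rw [hw, map_add, map_smul, map_smul]
    rfl
  rw [split] at eq1 eq2
  simp only [Pi.div_apply]
  rw [div_eq_div_iff hdet0 (pow_ne_zero 3 hr)]
  linear_combination (-(fderiv ℝ χ (r, 0) (1, 0)).1) * eq2 + (fderiv ℝ χ (r, 0) (0, 1)).1 * eq1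

theorem partialSnd_comp_shift {f : ℝ × ℝ → ℝ} (hf : ContDiff ℝ (⊤ : ℕ∞) f) {g : ℝ → ℝ}
    (hg : ContDiff ℝ (⊤ : ℕ∞) g) :
    partialSnd (fun p => f (p.1, g p.1 + p.2)) = fun p => partialSnd f (p.1, g p.1 + p.2) := by
  funext ⟨t, u⟩
  have hF : ContDiff ℝ (⊤ : ℕ∞) (fun p : ℝ × ℝ => f (p.1, g p.1 + p.2)) :=
    hf.comp (contDiff_fst.prodMk ((hg.comp contDiff_fst).add contDiff_snd))
  refine (hF.hasDerivAt_partialSnd t u).unique ?_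
  exact ((hf.hasDerivAt_partialSnd t (g t + u)).comp u
    ((hasDerivAt_id u).const_add (g t))).congr_deriv (mul_one _)

/-- The normal form for a smooth germ that is right equivalent to `y₂ y₁³ + y₂³` by a `C¹` change of
coordinates tangent to the identity. -/
theorem exists_normalForm {ψ : ℝ × ℝ → ℝ} (hψ : ContDiff ℝ (⊤ : ℕ∞) ψ)
    {χ : ℝ × ℝ → ℝ × ℝ} (hχ0 : χ 0 = 0) (hχc : ContDiffAt ℝ 1 χ 0)
    (hχ : fderiv ℝ χ 0 = ContinuousLinearMap.id ℝ (ℝ × ℝ))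
    (h : ∀ᶠ y in 𝓝 (0 : ℝ × ℝ), ψ (χ y) = y.2 * y.1 ^ 3 + y.2 ^ 3) :
    ∃ (b₃ : ℝ × ℝ → ℝ) (b₁ b₀ ω : ℝ → ℝ), ContDiff ℝ (⊤ : ℕ∞) b₃ ∧ ContDiff ℝ (⊤ : ℕ∞) b₁ ∧
      ContDiff ℝ (⊤ : ℕ∞) b₀ ∧ ContDiff ℝ (⊤ : ℕ∞) ω ∧ b₃ (0, 0) ≠ 0 ∧ b₁ 0 ≠ 0 ∧
      ∀ᶠ x in 𝓝 (0 : ℝ × ℝ), ψ x = b₃ x * (x.2 - x.1 ^ 2 * ω x.1) ^ 3 +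
        x.2 * x.1 ^ 3 * b₁ x.1 + x.1 ^ 5 * b₀ x.1 := by
  have hχd : HasFDerivAt χ (ContinuousLinearMap.id ℝ (ℝ × ℝ)) 0 :=
    hχ ▸ (hχc.differentiableAt (by simp)).hasFDerivAt
  obtain ⟨j1, j2, j3⟩ := threeJet_of_comp_eq hψ hχ0 hχd h
  obtain ⟨g, hg, hg0, hg1, hgz⟩ :=
    exists_contDiff_implicit hψ.partialSnd.partialSnd j1 j2 (by rw [j3]; norm_num)
  obtain ⟨g₁, hg₁, eg₁⟩ := hg.exists_eq_add_id_mul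
  have hg₁0 : g₁ 0 = 0 := by
    have hd := (hasDerivAt_id (0 : ℝ)).mul (hg₁.differentiable (by simp) 0).hasDerivAt
    have he : g = fun t => id t * g₁ t := by
      funext t
      simp [eg₁ t, hg0]
    have hd' : HasDerivAt g (deriv g 0) 0 := (hg.differentiable (by simp) 0).hasDerivAt
    rw [hg1, he] at hd'
    simpa using hd.unique hd'
  obtain ⟨ω, hω, eω⟩ := hg₁.exists_eq_add_id_mul
  have egω : ∀ t, g t = t ^ 2 * ω t := fun t => by rw [eg₁, eω, hg0, hg₁0]; ring
  let F : ℝ × ℝ → ℝ := fun p => ψ (p.1, g p.1 + p.2)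
  have hF : ContDiff ℝ (⊤ : ℕ∞) F :=
    hψ.comp (contDiff_fst.prodMk ((hg.comp contDiff_fst).add contDiff_snd))
  have hF1 : partialSnd F = fun p => partialSnd ψ (p.1, g p.1 + p.2) :=
    partialSnd_comp_shift hψ hg
  have hF2 : partialSnd (partialSnd F) =
      fun p => partialSnd (partialSnd ψ) (p.1, g p.1 + p.2) := by
    rw [hF1, partialSnd_comp_shift hψ.partialSnd hg]
  have hF3 : partialSnd (partialSnd (partialSnd F)) =
      fun p => partialSnd (partialSnd (partialSnd ψ)) (p.1, g p.1 + p.2) := by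
    rw [hF2, partialSnd_comp_shift hψ.partialSnd.partialSnd hg]
  obtain ⟨B, A, C, b, hB, hA, -, hb, hFe⟩ := hF.exists_cubic_expansion
  have hC : ∀ᶠ t in 𝓝 0, C t = 0 := by
    filter_upwards [hgz] with t ht
    have := partialSnd_partialSnd_of_cubic_expansion hF hb hFe t 0
    rw [hF2] at this
    simp only [add_zero, ht] at this
    linarith
  have hb0 : b (0, 0) = 1 := by
    have := partialSnd_partialSnd_partialSnd_of_cubic_expansion hF hb hFe 0
    rw [hF3] at this
    simp only [add_zero, hg0, j3] at this
    linarith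
  obtain ⟨X, Y, hX, hY, hXY⟩ := hχd.exists_tendsto_rescaled hχ0 (1, 0)
  have hq := tendsto_partialSnd_div_cube hψ hχc hχ h
  set q : ℝ → ℝ := fun r => partialSnd ψ (χ (r, 0)) / r ^ 3
  have hid : Tendsto (fun r : ℝ => r) (𝓝[≠] 0) (𝓝 0) :=
    tendsto_nhdsWithin_of_tendsto_nhds tendsto_id
  have hτ : Tendsto (fun r => r * X r) (𝓝[≠] 0) (𝓝 0) := by simpa using hid.mul hX
  have hX0 : ∀ᶠ r in 𝓝[≠] (0 : ℝ), X r ≠ 0 := hX.eventually_ne one_ne_zero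
  have hτne : Tendsto (fun r => r * X r) (𝓝[≠] 0) (𝓝[≠] 0) := by
    refine tendsto_nhdsWithin_iff.2 ⟨hτ, ?_⟩
    filter_upwards [hX0, self_mem_nhdsWithin] with r h1 h2
    exact mul_ne_zero h2 h1
  let Z : ℝ → ℝ := fun r => Y r - r * X r ^ 2 * ω (r * X r)
  have hZ : Tendsto Z (𝓝[≠] 0) (𝓝 0) := by
    simpa using hY.sub ((hid.mul (hX.pow 2)).mul ((hω.continuous.tendsto 0).comp hτ))
  have hpair : Tendsto (fun r => (r * X r, r * Z r)) (𝓝[≠] 0) (𝓝 (0, 0)) :=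
    hτ.prodMk_nhds (by simpa using hid.mul hZ)
  have hbt : Tendsto (fun r => b (r * X r, r * Z r)) (𝓝[≠] 0) (𝓝 1) :=
    hb0 ▸ (hb.continuous.tendsto (0, 0)).comp hpair
  let e : ℝ → ℝ := fun r =>
    3 * b (r * X r, r * Z r) + r * Z r * partialSnd b (r * X r, r * Z r)
  have he : Tendsto e (𝓝[≠] 0) (𝓝 3) := by
    simpa using (hbt.const_mul 3).add
      ((hid.mul hZ).mul ((hb.partialSnd.continuous.tendsto (0, 0)).comp hpair))
  have hpt : ∀ᶠ r in 𝓝[≠] (0 : ℝ), χ (r, 0) = (r * X r, g (r * X r) + r * Z r) := by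
    filter_upwards [hXY] with r hr
    have hv : r • ((1 : ℝ), (0 : ℝ)) = (r, 0) := by simp
    rw [← hv, hr, egω]
    congr 1
    ring
  have hCτ : ∀ᶠ r in 𝓝[≠] (0 : ℝ), C (r * X r) = 0 := hτ.eventually hC
  have eqA : ∀ᶠ r in 𝓝[≠] (0 : ℝ), A (r * X r) = r ^ 3 * q r - r ^ 2 * (Z r ^ 2 * e r) := by
    filter_upwards [hpt, hCτ, self_mem_nhdsWithin] with r h1 h2 h3
    have h3 : r ≠ 0 := h3
    have := partialSnd_of_cubic_expansion hF hb hFe (r * X r) (r * Z r)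
    rw [hF1, h2] at this
    simp only [← h1] at this
    have hqr : r ^ 3 * q r = partialSnd ψ (χ (r, 0)) := by
      simp only [q]
      field_simp
    rw [hqr, this]
    ring
  have hline : Tendsto (fun r : ℝ => (r, (0 : ℝ))) (𝓝[≠] 0) (𝓝 0) :=
    ((show Continuous fun t : ℝ => (t, (0 : ℝ)) by fun_prop).tendsto 0).mono_left nhdsWithin_le_nhds
  have eqB : ∀ᶠ r in 𝓝[≠] (0 : ℝ), B (r * X r) + r * Z r * A (r * X r) +
      (r * Z r) ^ 3 * b (r * X r, r * Z r) = 0 := by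
    filter_upwards [hpt, hCτ, hline.eventually h] with r h1 h2 h3
    have h4 := hFe (r * X r) (r * Z r)
    simp only [F] at h4
    rw [← h1, h3, h2] at h4
    linarith
  obtain ⟨α, hα, eα⟩ := hA.exists_eq_pow_succ_mul hτne 2 (by
    have hl := ((hid.mul hq).sub ((hZ.pow 2).mul he)).div (hX.pow 2) (by norm_num)
    norm_num at hl
    refine hl.congr' ?_
    filter_upwards [eqA, hX0, self_mem_nhdsWithin] with r h1 h2 h3
    have h3 : r ≠ 0 := h3
    simp only [Pi.div_apply]
    rw [h1]
    field_simp)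
  have hατ : Tendsto (fun r => α (r * X r)) (𝓝[≠] 0) (𝓝 (α 0)) :=
    (hα.continuous.tendsto 0).comp hτ
  have hZe : Tendsto (fun r => Z r ^ 2 * e r / r) (𝓝[≠] 0) (𝓝 (1 - α 0)) := by
    have hl := hq.sub ((hX.pow 3).mul hατ)
    rw [one_pow, one_mul] at hl
    refine hl.congr' ?_
    filter_upwards [eqA, self_mem_nhdsWithin] with r h1 h3
    have h3 : r ≠ 0 := h3
    rw [eα] at h1
    rw [eq_div_iff h3]
    refine mul_left_cancel₀ (pow_ne_zero 2 h3) ?_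
    linear_combination -h1
  have hα0 : 1 ≤ α 0 := by
    have hle : 𝓝[<] (0 : ℝ) ≤ 𝓝[≠] 0 := nhdsWithin_mono _ fun r hr => ne_of_lt hr
    have := le_of_tendsto (hZe.mono_left hle) (b := 0) (by
      filter_upwards [self_mem_nhdsWithin, (he.mono_left hle).eventually_const_lt
        (show (0 : ℝ) < 3 by norm_num)] with r h1 h2
      exact div_nonpos_of_nonneg_of_nonpos (by positivity) (le_of_lt h1))
    linarith
  have he0 : ∀ᶠ r in 𝓝[≠] (0 : ℝ), e r ≠ 0 := he.eventually_ne three_ne_zero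
  obtain ⟨β, hβ, eβ⟩ := hB.exists_eq_pow_succ_mul hτne 4 (by
    have hl := (((hZ.mul ((hX.pow 3).mul hατ)).add ((hZ.mul hbt).mul
      (hZe.div he three_ne_zero))).neg).div (hX.pow 4) (by norm_num)
    norm_num at hl
    refine hl.congr' ?_
    filter_upwards [eqB, hX0, he0, self_mem_nhdsWithin] with r h1 h2 h4 h3
    have h3 : r ≠ 0 := h3
    rw [eα] at h1
    have hBr : B (r * X r) = -(r ^ 4 * Z r * X r ^ 3 * α (r * X r)) -
        r ^ 3 * Z r ^ 3 * b (r * X r, r * Z r) := by linear_combination h1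
    simp only [Pi.div_apply]
    rw [hBr]
    field_simp
    ring)
  refine ⟨fun x => b (x.1, x.2 - x.1 ^ 2 * ω x.1), α, fun t => β t - ω t * α t, ω,
    hb.comp (contDiff_fst.prodMk (contDiff_snd.sub
      ((contDiff_fst.pow 2).mul (hω.comp contDiff_fst)))), hα, hβ.sub (hω.mul hα), hω,
    by simp [hb0], by linarith, ?_⟩
  filter_upwards [(continuous_fst.tendsto (0 : ℝ × ℝ)).eventually hC] with x hx
  have h1 := hFe x.1 (x.2 - x.1 ^ 2 * ω x.1)
  rw [hx, eα, eβ] at h1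
  simp only [F, egω, add_sub_cancel] at h1
  rw [show x = (x.1, x.2) from rfl, h1]
  ring

/-- a `C^∞` function with an `E₇` type singularity at the origin can be
written, after an invertible linear change of variables, as
`b₃(x)·(x₂ - x₁^m ω(x₁))³ + x₂ x₁³ b₁(x₁) + x₁^{k₀} b₀(x₁)` with `b₃(0,0) ≠ 0`,
`b₁(0) ≠ 0`, `m ≥ 2` and `k₀ ≥ 5`, where `b₃, b₁, b₀, ω` are `C^∞` near the origin. -/
theorem stmt_6 (U : Set (ℝ × ℝ)) (hU : U ∈ nhds (0 : ℝ × ℝ))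
    (φ : ℝ × ℝ → ℝ) (hφ : ContDiffOn ℝ (⊤ : ℕ∞) φ U) (h : HasE7 φ U) :
    ∃ T : (ℝ × ℝ) →ₗ[ℝ] ℝ × ℝ, Function.Bijective T ∧
    ∃ m k₀ : ℕ, 2 ≤ m ∧ 5 ≤ k₀ ∧
    ∃ (b₃ : ℝ × ℝ → ℝ) (b₁ b₀ ω : ℝ → ℝ) (δ : ℝ), 0 < δ ∧
      ContDiffOn ℝ (⊤ : ℕ∞) b₃ (Metric.ball (0 : ℝ × ℝ) δ) ∧
      ContDiffOn ℝ (⊤ : ℕ∞) b₁ (Ioo (-δ) δ) ∧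
      ContDiffOn ℝ (⊤ : ℕ∞) b₀ (Ioo (-δ) δ) ∧
      ContDiffOn ℝ (⊤ : ℕ∞) ω (Ioo (-δ) δ) ∧
      b₃ (0, 0) ≠ 0 ∧ b₁ 0 ≠ 0 ∧
      ∀ x ∈ Metric.ball (0 : ℝ × ℝ) δ,
        φ (T x) = b₃ x * (x.2 - x.1 ^ m * ω x.1) ^ 3 +
          x.2 * x.1 ^ 3 * b₁ x.1 + x.1 ^ k₀ * b₀ x.1 := by
  obtain ⟨V, hV, ϕ, hϕ, hϕ0, -, hdet, hE⟩ := h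
  have hϕc : ContDiffAt ℝ 1 ϕ 0 := hϕ.contDiffAt hV
  let L : (ℝ × ℝ) ≃L[ℝ] ℝ × ℝ := (fderiv ℝ ϕ 0).toContinuousLinearEquivOfDetNeZero hdet
  have hL : (L : ℝ × ℝ →L[ℝ] ℝ × ℝ) = fderiv ℝ ϕ 0 :=
    ContinuousLinearMap.coe_toContinuousLinearEquivOfDetNeZero _ _
  have hφL : ContDiffOn ℝ (⊤ : ℕ∞) (fun x => φ (L x)) (L ⁻¹' U) :=
    hφ.comp L.contDiff.contDiffOn fun _ hx => hx
  have hLU : L ⁻¹' U ∈ 𝓝 (0 : ℝ × ℝ) :=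
    L.continuous.continuousAt.preimage_mem_nhds (by rwa [map_zero])
  obtain ⟨ψ, hψ, hψe⟩ := hφL.exists_contDiff_eventuallyEq hLU
  have hχ0 : L.symm (ϕ 0) = 0 := by rw [hϕ0, map_zero]
  have hχc : ContDiffAt ℝ 1 (fun y => L.symm (ϕ y)) 0 := L.symm.contDiff.contDiffAt.comp 0 hϕc
  have hχ : fderiv ℝ (fun y => L.symm (ϕ y)) 0 = ContinuousLinearMap.id ℝ (ℝ × ℝ) := by
    have hd := (L.symm.hasFDerivAt (x := ϕ 0)).comp 0
      (hϕc.differentiableAt (by simp)).hasFDerivAt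
    rw [← hL] at hd
    exact hd.fderiv.trans (L.coe_symm_comp_coe)
  have hχt : Tendsto (fun y => L.symm (ϕ y)) (𝓝 0) (𝓝 0) := by
    simpa [hϕ0] using hχc.continuousAt.tendsto
  obtain ⟨b₃, b₁, b₀, ω, hb₃, hb₁, hb₀, hω, h3, h1, hform⟩ :=
    exists_normalForm hψ hχ0 hχc hχ (by
      filter_upwards [hχt.eventually hψe, hV] with y hy hyV
      rw [hy, L.apply_symm_apply, hE y hyV])
  obtain ⟨δ, hδ, hball⟩ := Metric.eventually_nhds_iff_ball.1 (hform.and hψe)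
  refine ⟨(L : (ℝ × ℝ) →ₗ[ℝ] ℝ × ℝ), L.bijective, 2, 5, le_rfl, le_rfl, b₃, b₁, b₀, ω, δ, hδ,
    hb₃.contDiffOn, hb₁.contDiffOn, hb₀.contDiffOn, hω.contDiffOn, h3, h1, fun x hx => ?_⟩
  obtain ⟨hx1, hx2⟩ := hball x hx
  exact hx2.symm.trans hx1
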